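/- For every positive integer n, the number of ordered pairs (a, b) of nonnegative integers such that G_a + 2G_b = n is odd if and only if n is a triangular number (n = T_m for some integer m ≥ 0). -/

import Mathlib

/-- The `n`-th triangular number `T n = n(n+1)/2`. -/
def T (n : ℕ) : ℕ := n * (n + 1) / 2

/-- The `n`-th generalized pentagonal number `G n = T n - T ⌊n/2⌋`. -/
def G (n : ℕ) : ℕ := T n - T (n / 2)

/-- The representations of `M` as `x² + 2y²` with `x`, `y` natural numbers prime to `3`. -/
def CoprimeReps (M : ℕ) : Set (ℕ × ℕ) :=
  {p | ¬ 3 ∣ p.1 ∧ ¬ 3 ∣ p.2 ∧ p.1 ^ 2 + 2 * p.2 ^ 2 = M}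

/-- The representations of `N` as `u² + 2v²` with `u ≥ 0` such that multiplying
`u + v√-2` by `1 + √-2` gives a number whose coordinates are prime to `3`. -/
def SignedReps (N : ℕ) : Set (ℕ × ℤ) :=
  {p | (p.1 : ℤ) ^ 2 + 2 * p.2 ^ 2 = N ∧ ¬ (3 : ℤ) ∣ p.1 + p.2}

theorem two_mul_T (n : ℕ) : 2 * T n = n * (n + 1) :=
  Nat.mul_div_cancel' (Nat.even_mul_succ_self n).two_dvd

theorem T_mono : Monotone T := fun _ _ h =>
  Nat.div_le_div_right (Nat.mul_le_mul h (Nat.succ_le_succ h))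

theorem twentyfour_mul_G_add_one (a : ℕ) : 24 * G a + 1 = (3 * a + 1 + a % 2) ^ 2 := by
  have h1 := two_mul_T a
  have h2 := two_mul_T (a / 2)
  have h3 : G a + T (a / 2) = T a := Nat.sub_add_cancel (T_mono (Nat.div_le_self a 2))
  have h4 := Nat.div_add_mod a 2
  generalize a / 2 = k at *
  rcases Nat.mod_two_eq_zero_or_one a with h | h <;> rw [h] at h4 ⊢ <;> subst h4 <;> nlinarith

theorem card_G_add_two_mul_G (n : ℕ) :
    Nat.card {p : ℕ × ℕ // G p.1 + 2 * G p.2 = n} = Nat.card (CoprimeReps (3 * (8 * n + 1))) := by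
  refine Nat.card_congr (Equiv.ofBijective
    (fun p => ⟨(3 * p.1.1 + 1 + p.1.1 % 2, 3 * p.1.2 + 1 + p.1.2 % 2), by omega, by omega, ?_⟩)
    ⟨?_, ?_⟩)
  · obtain ⟨⟨a, b⟩, h⟩ := p
    dsimp only at h ⊢
    rw [← twentyfour_mul_G_add_one, ← twentyfour_mul_G_add_one]
    omega
  · rintro ⟨⟨a, b⟩, h⟩ ⟨⟨c, d⟩, h'⟩ e
    simp only [Subtype.ext_iff, Prod.mk.injEq] at e ⊢
    omega
  · rintro ⟨⟨x, y⟩, hx, hy, h⟩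
    dsimp only at hx hy h
    have hx2 : x % 2 = 1 := by
      rcases Nat.mod_two_eq_zero_or_one x with h2 | h2
      · have := (Nat.pow_mod x 2 2)
        rw [h2] at this
        omega
      · exact h2
    have hy2 : y % 2 = 1 := by
      rcases Nat.mod_two_eq_zero_or_one y with h2 | h2
      · have h5 : y ^ 2 % 2 = 0 := by rw [Nat.pow_mod, h2]
        have h6 : x ^ 2 % 4 = 1 := by
          have : x % 4 = 1 ∨ x % 4 = 3 := by omega
          rcases this with h | h <;> rw [Nat.pow_mod, h]
        omega
      · exact h2
    have ex : 3 * (x / 3) + 1 + x / 3 % 2 = x := by omega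
    have ey : 3 * (y / 3) + 1 + y / 3 % 2 = y := by omega
    refine ⟨⟨(x / 3, y / 3), ?_⟩, ?_⟩
    · have h1 := twentyfour_mul_G_add_one (x / 3)
      have h2 := twentyfour_mul_G_add_one (y / 3)
      rw [ex] at h1
      rw [ey] at h2
      dsimp only
      omega
    · simp only [ex, ey]

/-- Multiplication by `1 + √-2`. -/
theorem card_coprimeReps_three_mul {N : ℕ} (hN : Odd N) :
    Nat.card (CoprimeReps (3 * N)) = Nat.card (SignedReps N) := by
  symm
  refine Nat.card_congr (Equiv.ofBijective
    (fun p => ⟨(((p.1.1 : ℤ) - 2 * p.1.2).natAbs, ((p.1.1 : ℤ) + p.1.2).natAbs), ?_, ?_, ?_⟩)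
    ⟨?_, ?_⟩)
  · have := p.2.2
    dsimp only
    omega
  · have := p.2.2
    dsimp only
    omega
  · have := p.2.1
    zify
    rw [sq_abs, sq_abs]
    linarith
  · rintro ⟨⟨u, v⟩, h, h3⟩ ⟨⟨u', v'⟩, h', h3'⟩ e
    simp only [Subtype.ext_iff, Prod.mk.injEq] at e h h3 h' h3' ⊢
    have hu : u ≠ 0 := by
      rintro rfl
      obtain ⟨k, rfl⟩ := hN
      push_cast at h
      omega
    omega
  · rintro ⟨⟨x, y⟩, hx, hy, h⟩
    dsimp only at hx hy h
    obtain ⟨s, hs, hsx⟩ : ∃ s : ℤ, s.natAbs = y ∧ (3 : ℤ) ∣ s - x := by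
      by_cases hxy : (3 : ℤ) ∣ y - x
      · exact ⟨y, by omega, hxy⟩
      · have h1 : x % 3 = 1 ∨ x % 3 = 2 := by omega
        have h2 : y % 3 = 1 ∨ y % 3 = 2 := by omega
        exact ⟨-y, by omega, by omega⟩
    obtain ⟨v, hv⟩ := hsx
    obtain ⟨u, hu⟩ : ∃ u : ℤ, u = s - v := ⟨_, rfl⟩
    have hs' : s = u + v := by omega
    have hx' : (x : ℤ) = u - 2 * v := by omega
    have key : u ^ 2 + 2 * v ^ 2 = N := by
      zify at h
      have : (y : ℤ) ^ 2 = s ^ 2 := by rw [← hs, Int.natCast_natAbs, sq_abs]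
      rw [this, hs', hx'] at h
      linarith
    rcases le_total 0 u with h0 | h0
    · refine ⟨⟨(u.natAbs, v), ?_, ?_⟩, ?_⟩
      · dsimp only
        rw [Int.natCast_natAbs, sq_abs, key]
      · dsimp only
        omega
      · simp only [Subtype.ext_iff, Prod.mk.injEq]
        omega
    · refine ⟨⟨(u.natAbs, -v), ?_, ?_⟩, ?_⟩
      · dsimp only
        rw [Int.natCast_natAbs, sq_abs, neg_sq, key]
      · dsimp only
        omega
      · simp only [Subtype.ext_iff, Prod.mk.injEq]
        omega

theorem three_dvd_sq_add_two_mul_sq (u v : ℤ) :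
    (3 : ℤ) ∣ u ^ 2 + 2 * v ^ 2 ↔ 3 ∣ u + v ∨ 3 ∣ u - v := by
  rw [← Int.prime_three.dvd_mul, show u ^ 2 + 2 * v ^ 2 = (u + v) * (u - v) + 3 * v ^ 2 by ring]
  exact dvd_add_left (dvd_mul_right _ _)

theorem card_signedReps_of_three_dvd {N : ℕ} (hN : 3 ∣ N) :
    Nat.card (SignedReps N) = Nat.card (CoprimeReps N) := by
  have hN' : (3 : ℤ) ∣ N := by exact_mod_cast hN
  refine Nat.card_congr (Equiv.ofBijective
    (fun p => ⟨(p.1.1, p.1.2.natAbs), ?_, ?_, ?_⟩) ⟨?_, ?_⟩)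
  · obtain ⟨⟨u, v⟩, h, h3⟩ := p
    dsimp only at h h3 ⊢
    rw [← h, three_dvd_sq_add_two_mul_sq] at hN'
    omega
  · obtain ⟨⟨u, v⟩, h, h3⟩ := p
    dsimp only at h h3 ⊢
    rw [← h, three_dvd_sq_add_two_mul_sq] at hN'
    omega
  · have := p.2.1
    zify
    rwa [sq_abs]
  · rintro ⟨⟨u, v⟩, h, h3⟩ ⟨⟨u', v'⟩, h', h3'⟩ e
    simp only [Subtype.ext_iff, Prod.mk.injEq] at e h h3 h' h3' ⊢
    rw [← h, three_dvd_sq_add_two_mul_sq] at hN'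
    omega
  · rintro ⟨⟨x, y⟩, hx, hy, h⟩
    dsimp only at hx hy h
    zify at h
    by_cases hxy : (3 : ℤ) ∣ x + y
    · exact ⟨⟨(x, -y), by simpa using h, by dsimp only; omega⟩, by simp⟩
    · exact ⟨⟨(x, y), h, hxy⟩, by simp⟩

theorem finite_signedReps (N : ℕ) : (SignedReps N).Finite := by
  refine ((Set.finite_Iic N).prod (Set.finite_Icc (-(N : ℤ)) N)).subset ?_
  rintro ⟨u, v⟩ ⟨h, -⟩
  dsimp only at h
  simp only [Set.mem_prod, Set.mem_Iic, Set.mem_Icc]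
  refine ⟨?_, ?_, ?_⟩
  · zify
    nlinarith [sq_nonneg v, Int.le_self_sq (u : ℤ)]
  · nlinarith [sq_nonneg (u : ℤ), Int.le_self_sq (-v)]
  · nlinarith [sq_nonneg (u : ℤ), Int.le_self_sq v]

/-- The sign change `v ↦ -v` pairs off the representations with `v ≠ 0`. -/
theorem odd_card_signedReps {N : ℕ} (hN : ¬ 3 ∣ N) :
    Odd (Nat.card (SignedReps N)) ↔ ∃ s, N = s ^ 2 := by
  classical
  have hN' : ¬ (3 : ℤ) ∣ N := by exact_mod_cast hN
  have hmem (u : ℕ) (v : ℤ) : (u, v) ∈ SignedReps N ↔ (u : ℤ) ^ 2 + 2 * v ^ 2 = N := by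
    refine ⟨fun h => h.1, fun h => ⟨h, fun h3 => hN' ?_⟩⟩
    rw [← h, three_dvd_sq_add_two_mul_sq]
    exact Or.inl h3
  have := (finite_signedReps N).fintype
  let f : Function.End (SignedReps N) := fun p => ⟨(p.1.1, -p.1.2), by
    rw [hmem, neg_sq]; exact p.2.1⟩
  have hf : f ^ 2 ^ 1 = 1 := by
    rw [pow_one, pow_two]
    funext p
    exact Subtype.ext (Prod.ext rfl (neg_neg p.1.2))
  have hcard := Equiv.Perm.card_fixedPoints_modEq hf
  have hfix (p : SignedReps N) : p ∈ Function.fixedPoints f ↔ p.1.2 = 0 := by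
    obtain ⟨⟨u, v⟩, h⟩ := p
    rw [Function.mem_fixedPoints, Function.IsFixedPt, Subtype.ext_iff]
    change (u, -v) = (u, v) ↔ v = 0
    simp [neg_eq_self]
  rw [Nat.card_eq_fintype_card, Nat.odd_iff, show _ % 2 = _ % 2 from hcard]
  have hsub : Subsingleton (Function.fixedPoints f) := by
    refine ⟨fun p q => ?_⟩
    obtain ⟨⟨⟨u, v⟩, h⟩, hp⟩ := p
    obtain ⟨⟨⟨u', v'⟩, h'⟩, hq⟩ := q
    rw [hfix] at hp hq
    rw [hmem] at h h'
    dsimp only at hp hq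
    subst hp hq
    have : u = u' := by
      rw [← h'] at h
      have : u ^ 2 = u' ^ 2 := by zify; linarith
      exact Nat.pow_left_injective two_ne_zero this
    simp [this]
  have hle := Fintype.card_le_one_iff_subsingleton.2 hsub
  have hpos : 0 < Fintype.card (Function.fixedPoints f) ↔ ∃ s, N = s ^ 2 := by
    rw [Fintype.card_pos_iff]
    constructor
    · rintro ⟨⟨⟨⟨u, v⟩, h⟩, hp⟩⟩
      rw [hfix] at hp
      rw [hmem] at h
      dsimp only at hp
      subst hp
      exact ⟨u, by zify; linarith⟩
    · rintro ⟨s, rfl⟩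
      exact ⟨⟨⟨(s, 0), by rw [hmem]; push_cast; ring⟩, by rw [hfix]⟩⟩
  rw [← hpos]
  omega

theorem odd_card_coprimeReps_three_mul (N : ℕ) (hN : Odd N) :
    Odd (Nat.card (CoprimeReps (3 * N))) ↔ ∃ k s, N = 3 ^ k * s ^ 2 := by
  induction N using Nat.strong_induction_on with
  | _ N ih =>
    rw [card_coprimeReps_three_mul hN]
    by_cases h3 : 3 ∣ N
    · rw [card_signedReps_of_three_dvd h3]
      obtain ⟨M, rfl⟩ := h3
      have hM : Odd M := (Nat.odd_mul.1 hN).2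
      rw [ih M (by have := hM.pos; omega) hM]
      constructor
      · rintro ⟨k, s, rfl⟩
        exact ⟨k + 1, s, by ring⟩
      · rintro ⟨_ | k, s, h⟩
        · obtain ⟨t, rfl⟩ : 3 ∣ s :=
            Nat.prime_three.dvd_of_dvd_pow (n := 2) ⟨M, by rw [h]; ring⟩
          exact ⟨1, t, by linarith⟩
        · exact ⟨k, s, by rw [pow_succ] at h; linarith⟩
    · rw [odd_card_signedReps h3]
      constructor
      · rintro ⟨s, h⟩
        exact ⟨0, s, by simpa using h⟩
      · rintro ⟨_ | k, s, h⟩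
        · exact ⟨s, by simpa using h⟩
        · exact absurd ⟨3 ^ k * s ^ 2, by rw [h]; ring⟩ h3

theorem exists_eq_T_iff (n : ℕ) : (∃ m, n = T m) ↔ ∃ k s, 8 * n + 1 = 3 ^ k * s ^ 2 := by
  constructor
  · rintro ⟨m, rfl⟩
    exact ⟨0, 2 * m + 1, by linarith [two_mul_T m]⟩
  · rintro ⟨k, s, h⟩
    have hs : s ^ 2 % 8 = 1 := by
      have hodd : Odd (s ^ 2) := by
        have : Odd (3 ^ k * s ^ 2) := by rw [← h]; exact ⟨4 * n, by ring⟩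
        exact (Nat.odd_mul.1 this).2
      have h2 : s % 2 = 1 := Nat.odd_iff.1 (Nat.Odd.of_mul_left (pow_two s ▸ hodd))
      have : s % 8 = 1 ∨ s % 8 = 3 ∨ s % 8 = 5 ∨ s % 8 = 7 := by omega
      rcases this with h | h | h | h <;> rw [Nat.pow_mod, h]
    obtain ⟨j, rfl | rfl⟩ := Nat.even_or_odd' k
    · have hr : 8 * n + 1 = (3 ^ j * s) ^ 2 := by rw [h]; ring
      obtain ⟨m, hm⟩ : Odd (3 ^ j * s) := by
        have : Odd ((3 ^ j * s) ^ 2) := by rw [← hr]; exact ⟨4 * n, by ring⟩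
        exact Nat.Odd.of_mul_left (pow_two (3 ^ j * s) ▸ this)
      rw [hm] at hr
      exact ⟨m, by linarith [two_mul_T m]⟩
    · have h9 : 3 ^ (2 * j + 1) % 8 = 3 := by
        rw [pow_succ, pow_mul, Nat.mul_mod, Nat.pow_mod]
        norm_num
      have := Nat.mul_mod (3 ^ (2 * j + 1)) (s ^ 2) 8
      rw [← h, h9, hs] at this
      omega

theorem stmt_2 (n : ℕ) (hn : 0 < n) :
    Odd (Nat.card {p : ℕ × ℕ // G p.1 + 2 * G p.2 = n}) ↔ ∃ m, n = T m := by
  rw [card_G_add_two_mul_G, exists_eq_T_iff]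
  exact odd_card_coprimeReps_three_mul _ ⟨4 * n, by ring⟩
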